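/- Let A and B be finite direct sums of complex matrix algebras, let ρ : A → B be a unital *-homomorphism, and let α : Γ(B) → [0,∞) be an increasing function with α(0) = 0, with associated Choquet formula φ_α on B⁺. Then for every a ∈ A⁺, writing λ_1(a) > λ_2(a) > ⋯ > λ_{K_a}(a) ≥ 0 for the distinct spectral values of a (with the convention λ_{K_a+1}(a) := 0), one has φ_α(ρ(a)) = Σ_{j=1}^{K_a} (λ_j(a) − λ_{j+1}(a)) α(rk(ρ(E_a([λ_j(a), ∞))))), where E_a([t,∞)) denotes the spectral projection of a onto [t,∞) and rk denotes the rank vector of a projection in B. -/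

import Mathlib

open Matrix
open scoped ComplexOrder

/-- The dimension scale `Γ(A) = {0,1,…,k 1} × ⋯ × {0,1,…,k L}` of the finite direct sum of
matrix algebras `A = ⊕ₛ M_{k s}(ℂ)`, equipped with the componentwise order. -/
abbrev DimScale {L : ℕ} (k : Fin L → ℕ) := ∀ s : Fin L, Fin (k s + 1)

/-- `r(a;t)`: the rank vector of the spectral projection `E_a([t,∞))` of a positive element
`a = ⊕ₛ aₛ`; its `s`-th component is the number of eigenvalues of the `s`-th block of `a`,
counted with multiplicity, that are `≥ t`. -/
noncomputable def rankVec {L : ℕ} {k : Fin L → ℕ} (a : ∀ s, Matrix (Fin (k s)) (Fin (k s)) ℂ)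
    (ha : ∀ s, (a s).PosSemidef) (t : ℝ) : DimScale k := fun s =>
  ⟨(Finset.univ.filter fun i => t ≤ (ha s).1.eigenvalues i).card,
    Nat.lt_succ_of_le (le_trans (Finset.card_filter_le _ _) (by simp))⟩

/-- The set of spectral values of a positive element `a = ⊕ₛ aₛ`, i.e. the set of eigenvalues
of the blocks of `a`. -/
noncomputable def specVals {L : ℕ} {k : Fin L → ℕ} (a : ∀ s, Matrix (Fin (k s)) (Fin (k s)) ℂ)
    (ha : ∀ s, (a s).PosSemidef) : Finset ℝ :=
  Finset.univ.biUnion fun s => Finset.univ.image (ha s).1.eigenvalues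

/-- Given the distinct spectral values `λ₁ > λ₂ > ⋯ > λ_K` as a (strictly decreasing) list,
the Choquet sum `Σ_{j=1}^{K} (λ_j − λ_{j+1}) • β (λ_j)` with the convention `λ_{K+1} = 0`. -/
noncomputable def choquetSumAux (β : ℝ → ℝ) : List ℝ → ℝ
  | [] => 0
  | [t] => t * β t
  | t₁ :: t₂ :: rest => (t₁ - t₂) * β t₁ + choquetSumAux β (t₂ :: rest)

/-- The Choquet formula `φ_α(a) = Σ_{j=1}^{K_a} (λ_j(a) − λ_{j+1}(a)) α(r(a; λ_j(a)))`, where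
`λ_1(a) > ⋯ > λ_{K_a}(a)` are the distinct spectral values of `a` in decreasing order and
`λ_{K_a+1}(a) := 0`. -/
noncomputable def phiAlpha {L : ℕ} {k : Fin L → ℕ} (α : DimScale k → ℝ)
    (a : ∀ s, Matrix (Fin (k s)) (Fin (k s)) ℂ) (ha : ∀ s, (a s).PosSemidef) : ℝ :=
  choquetSumAux (fun t => α (rankVec a ha t)) ((specVals a ha).sort (· ≤ ·)).reverse

/-- The continuous functional calculus `f(a)` of a positive element `a = ⊕ₛ aₛ`, applied
blockwise via the spectral theorem for Hermitian matrices. -/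
noncomputable def applyFun {L : ℕ} {k : Fin L → ℕ} (f : ℝ → ℝ)
    (a : ∀ s, Matrix (Fin (k s)) (Fin (k s)) ℂ) (ha : ∀ s, (a s).PosSemidef) :
    ∀ s, Matrix (Fin (k s)) (Fin (k s)) ℂ := fun s => (ha s).1.cfc f

/-- Abel-summed form of the Choquet sum. -/
noncomputable def abelSum (β : ℝ → ℝ) : ℝ → List ℝ → ℝ
  | _, [] => 0
  | b, t :: l => t * (β t - b) + abelSum β (β t) l

lemma choquet_eq_abel_cons (β : ℝ → ℝ) (b : ℝ) : ∀ (l : List ℝ) (t : ℝ),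
    choquetSumAux β (t :: l) = abelSum β b (t :: l) + t * b := by
  intro l
  induction l generalizing b with
  | nil => intro t; simp [choquetSumAux, abelSum]; ring
  | cons u l ih =>
    intro t
    rw [choquetSumAux, ih (β t) u]
    simp only [abelSum]
    ring

lemma choquet_eq_abel (β : ℝ → ℝ) (l : List ℝ) : choquetSumAux β l = abelSum β 0 l := by
  cases l with
  | nil => rfl
  | cons t l => rw [choquet_eq_abel_cons β 0]; ring

lemma abel_filter (β : ℝ → ℝ) (S : Finset ℝ)
    (H : ∀ t u, t ≤ u → (∀ x ∈ S, t ≤ x → u ≤ x) → β t = β u) :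
    ∀ (l : List ℝ) (u : ℝ), (u :: l).Pairwise (· > ·) → (∀ x ∈ S, x < u → x ∈ l) →
      abelSum β (β u) l = abelSum β (β u) (l.filter (· ∈ S)) := by
  intro l
  induction l with
  | nil => intros; rfl
  | cons t l ih =>
    intro u hp hS
    rw [List.pairwise_cons] at hp
    obtain ⟨h1, h2⟩ := hp
    have htu : t < u := h1 t (by simp)
    have hS' : ∀ x ∈ S, x < t → x ∈ l := by
      intro x hx hxt
      have := hS x hx (hxt.trans htu)
      rcases List.mem_cons.1 this with h | h
      · exact absurd h hxt.ne
      · exact h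
    have ih' := ih t h2 hS'
    by_cases ht : t ∈ S
    · rw [List.filter_cons_of_pos (by simpa using ht), abelSum, abelSum, ih']
    · rw [List.filter_cons_of_neg (by simpa using ht), abelSum]
      have : β t = β u := by
        apply H t u htu.le
        intro x hx htx
        by_contra hlt
        rcases List.mem_cons.1 (hS x hx (not_le.1 hlt)) with h | h
        · exact ht (h ▸ hx)
        · rw [List.pairwise_cons] at h2
          exact absurd (h2.1 x h) (not_lt.2 htx)
      rw [ih', this]; ring

lemma choquet_filter (β : ℝ → ℝ) (S : Finset ℝ)
    (H : ∀ t u, t ≤ u → (∀ x ∈ S, t ≤ x → u ≤ x) → β t = β u)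
    (H0 : ∀ t, (∀ x ∈ S, x < t) → β t = 0)
    (l : List ℝ) (hl : l.Pairwise (· > ·)) (hS : ∀ x ∈ S, x ∈ l) :
    choquetSumAux β l = choquetSumAux β (l.filter (· ∈ S)) := by
  obtain ⟨M, hM⟩ := l.toFinset.bddAbove
  have hM' : ∀ x ∈ l, x < M + 1 := fun x hx => by
    have := hM (a := x) (by simpa using hx)
    linarith
  have h0 : β (M + 1) = 0 := H0 _ fun x hx => hM' x (hS x hx)
  rw [choquet_eq_abel, choquet_eq_abel, ← h0]
  exact abel_filter β S H l (M + 1) (List.pairwise_cons.2 ⟨hM', hl⟩) fun x hx _ => hS x hx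

lemma choquet_ofFn (β : ℝ → ℝ) : ∀ (K : ℕ) (lam : Fin K → ℝ),
    choquetSumAux β (List.ofFn lam) = ∑ j : Fin K,
      (lam j - (if hj : (j : ℕ) + 1 < K then lam ⟨(j : ℕ) + 1, hj⟩ else 0)) * β (lam j) := by
  intro K
  induction K with
  | zero => intro lam; simp [choquetSumAux]
  | succ K ih =>
    intro lam
    rw [Fin.sum_univ_succ]
    have e : ∀ j : Fin K, (if hj : ((j.succ : Fin (K+1)) : ℕ) + 1 < K + 1 then
        lam ⟨((j.succ : Fin (K+1)) : ℕ) + 1, hj⟩ else 0) =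
        (if hj : (j : ℕ) + 1 < K then lam (Fin.succ ⟨(j : ℕ) + 1, hj⟩) else 0) := by
      intro j
      by_cases h : (j : ℕ) + 1 < K
      · rw [dif_pos h, dif_pos (by simpa using h)]; rfl
      · rw [dif_neg h, dif_neg (by simpa using h)]
    simp only [e]
    rw [← ih (fun j => lam j.succ)]
    cases K with
    | zero => simp [choquetSumAux]
    | succ K => simp [choquetSumAux, List.ofFn_succ]

lemma rank_cfc {n : ℕ} {A : Matrix (Fin n) (Fin n) ℂ} (hA : A.IsHermitian) (f : ℝ → ℝ) :
    (hA.cfc f).rank = (Finset.univ.filter fun i => f (hA.eigenvalues i) ≠ 0).card := by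
  rw [Matrix.IsHermitian.cfc, Unitary.conjStarAlgAut_apply,
    Matrix.rank_mul_eq_left_of_isUnit_det, Matrix.rank_mul_eq_right_of_isUnit_det,
    Matrix.rank_diagonal, Fintype.card_subtype]
  · simp
  · exact (Matrix.isUnit_iff_isUnit_det _).1 (Unitary.toUnits hA.eigenvectorUnitary).isUnit
  · exact (Matrix.isUnit_iff_isUnit_det _).1 (Unitary.toUnits (star hA.eigenvectorUnitary)).isUnit

lemma cfc_congr_eig {n : ℕ} {A : Matrix (Fin n) (Fin n) ℂ} (hA : A.IsHermitian) (f g : ℝ → ℝ)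
    (h : ∀ i, f (hA.eigenvalues i) = g (hA.eigenvalues i)) : hA.cfc f = hA.cfc g := by
  have : f ∘ hA.eigenvalues = g ∘ hA.eigenvalues := funext h
  rw [Matrix.IsHermitian.cfc, Matrix.IsHermitian.cfc, this]

lemma cfc_eval {n : ℕ} {A : Matrix (Fin n) (Fin n) ℂ} (hA : A.IsHermitian)
    (p : Polynomial ℝ) : hA.cfc (fun x => p.eval x) = Polynomial.aeval A p := by
  rw [← hA.cfc_eq]
  exact cfc_polynomial p A hA.isSelfAdjoint

lemma mem_specVals {L : ℕ} {k : Fin L → ℕ} (a : ∀ s, Matrix (Fin (k s)) (Fin (k s)) ℂ)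
    (ha : ∀ s, (a s).PosSemidef) (s : Fin L) (i : Fin (k s)) :
    (ha s).1.eigenvalues i ∈ specVals a ha := by
  simp only [specVals, Finset.mem_biUnion, Finset.mem_image, Finset.mem_univ, true_and]
  exact ⟨s, i, rfl⟩

lemma applyFun_eq_aeval {L : ℕ} {k : Fin L → ℕ} (a : ∀ s, Matrix (Fin (k s)) (Fin (k s)) ℂ)
    (ha : ∀ s, (a s).PosSemidef) (f : ℝ → ℝ) (p : Polynomial ℝ)
    (h : ∀ x ∈ specVals a ha, f x = p.eval x) :
    applyFun f a ha = Polynomial.aeval a p := by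
  funext s
  rw [applyFun, cfc_congr_eig (ha s).1 f (fun x => p.eval x)
    fun i => h _ (mem_specVals a ha s i), cfc_eval]
  exact Polynomial.aeval_algHom_apply
    (Pi.evalAlgHom ℝ (fun s => Matrix (Fin (k s)) (Fin (k s)) ℂ) s) a p

lemma map_applyFun_aeval {L : ℕ} {k : Fin L → ℕ} {L' : ℕ} {k' : Fin L' → ℕ}
    (ρ : (∀ s, Matrix (Fin (k s)) (Fin (k s)) ℂ) →⋆ₐ[ℂ]
      (∀ s', Matrix (Fin (k' s')) (Fin (k' s')) ℂ))
    (a : ∀ s, Matrix (Fin (k s)) (Fin (k s)) ℂ) (ha : ∀ s, (a s).PosSemidef)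
    (hρa : ∀ s', ((ρ a) s').PosSemidef) (f : ℝ → ℝ) (p : Polynomial ℝ)
    (h : ∀ x ∈ specVals a ha, f x = p.eval x) (s' : Fin L') :
    ρ (applyFun f a ha) s' = (hρa s').1.cfc (fun x => p.eval x) := by
  rw [applyFun_eq_aeval a ha f p h, cfc_eval]
  have := Polynomial.aeval_algHom_apply ((ρ.toAlgHom).restrictScalars ℝ) a p
  have h2 := Polynomial.aeval_algHom_apply
    (Pi.evalAlgHom ℝ (fun s => Matrix (Fin (k' s)) (Fin (k' s)) ℂ) s') (ρ a) p
  exact (congrFun this s').symm.trans h2.symm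

lemma specVals_map_subset {L : ℕ} {k : Fin L → ℕ} {L' : ℕ} {k' : Fin L' → ℕ}
    (ρ : (∀ s, Matrix (Fin (k s)) (Fin (k s)) ℂ) →⋆ₐ[ℂ]
      (∀ s', Matrix (Fin (k' s')) (Fin (k' s')) ℂ))
    (a : ∀ s, Matrix (Fin (k s)) (Fin (k s)) ℂ) (ha : ∀ s, (a s).PosSemidef)
    (hρa : ∀ s', ((ρ a) s').PosSemidef) : specVals (ρ a) hρa ⊆ specVals a ha := by
  intro x hx
  simp only [specVals, Finset.mem_biUnion, Finset.mem_image, Finset.mem_univ, true_and] at hx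
  obtain ⟨s', i, rfl⟩ := hx
  let q : Polynomial ℝ := ∏ y ∈ specVals a ha, (Polynomial.X - Polynomial.C y)
  have hq : ∀ x, q.eval x = 0 ↔ x ∈ specVals a ha := by
    intro x
    simp [q, Polynomial.eval_prod, Finset.prod_eq_zero_iff, sub_eq_zero]
  have h1 := map_applyFun_aeval ρ a ha hρa (fun _ => 0) q (fun x hx => ((hq x).2 hx).symm) s'
  have h0 : applyFun (fun _ => (0 : ℝ)) a ha = 0 := by
    rw [applyFun_eq_aeval a ha _ 0 (by simp), map_zero]
  rw [h0, map_zero] at h1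
  have h2 := rank_cfc (hρa s').1 (fun x => q.eval x)
  rw [← h1, Pi.zero_apply, Matrix.rank_zero, eq_comm, Finset.card_eq_zero] at h2
  by_contra hne
  have : i ∈ Finset.univ.filter fun i => q.eval ((hρa s').1.eigenvalues i) ≠ 0 := by
    simpa [hq] using hne
  rw [h2] at this
  simp at this

lemma rank_map_applyFun {L : ℕ} {k : Fin L → ℕ} {L' : ℕ} {k' : Fin L' → ℕ}
    (ρ : (∀ s, Matrix (Fin (k s)) (Fin (k s)) ℂ) →⋆ₐ[ℂ]
      (∀ s', Matrix (Fin (k' s')) (Fin (k' s')) ℂ))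
    (a : ∀ s, Matrix (Fin (k s)) (Fin (k s)) ℂ) (ha : ∀ s, (a s).PosSemidef)
    (hρa : ∀ s', ((ρ a) s').PosSemidef) (t : ℝ) (s' : Fin L') :
    (ρ (applyFun (fun x => if t ≤ x then 1 else 0) a ha) s').rank =
      (rankVec (ρ a) hρa t s' : ℕ) := by
  let f : ℝ → ℝ := fun x => if t ≤ x then 1 else 0
  let p := Lagrange.interpolate (specVals a ha) id f
  have hp : ∀ x ∈ specVals a ha, f x = p.eval x := fun x hx =>
    (Lagrange.eval_interpolate_at_node (v := id) f Function.injective_id.injOn hx).symm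
  have := map_applyFun_aeval ρ a ha hρa f p hp s'
  rw [← cfc_congr_eig (hρa s').1 f (fun x => p.eval x) fun i => hp _
    (specVals_map_subset ρ a ha hρa (mem_specVals _ hρa s' i))] at this
  change (ρ (applyFun f a ha) s').rank = _
  rw [this, rank_cfc]
  simp [f, rankVec]

/-- Compatibility of the Choquet formula with a unital `*`-homomorphism
`ρ : A → B` between finite direct sums of matrix algebras: for a positive `a ∈ A⁺` with
distinct spectral values `λ_1 > ⋯ > λ_K ≥ 0` (convention `λ_{K+1} := 0`),
`φ_α(ρ(a)) = Σ_{j=1}^{K} (λ_j − λ_{j+1}) α(rk(ρ(E_a([λ_j, ∞)))))`. -/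
theorem phiAlpha_comp_starAlgHom {L : ℕ} {k : Fin L → ℕ} {L' : ℕ} {k' : Fin L' → ℕ}
    (ρ : (∀ s, Matrix (Fin (k s)) (Fin (k s)) ℂ) →⋆ₐ[ℂ]
      (∀ s', Matrix (Fin (k' s')) (Fin (k' s')) ℂ))
    (α : DimScale k' → ℝ) (hα : Monotone α) (hα0 : α 0 = 0) (hαnonneg : ∀ x, 0 ≤ α x)
    (a : ∀ s, Matrix (Fin (k s)) (Fin (k s)) ℂ) (ha : ∀ s, (a s).PosSemidef)
    (K : ℕ) (lam : Fin K → ℝ) (hlam : StrictAnti lam) (hlamnonneg : ∀ j, 0 ≤ lam j)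
    (hspec : specVals a ha = Finset.univ.image lam)
    (hρa : ∀ s', ((ρ a) s').PosSemidef) :
    phiAlpha α (ρ a) hρa =
      ∑ j : Fin K,
        (lam j - (if hj : (j : ℕ) + 1 < K then lam ⟨(j : ℕ) + 1, hj⟩ else 0)) *
          α (fun s' => ⟨((ρ (applyFun (fun x => if lam j ≤ x then 1 else 0) a ha)) s').rank,
            Nat.lt_succ_of_le (le_trans (Matrix.rank_le_card_width _) (by simp))⟩) := by
  have hr : ∀ j : Fin K,
      (fun s' => ⟨((ρ (applyFun (fun x => if lam j ≤ x then 1 else 0) a ha)) s').rank,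
            Nat.lt_succ_of_le (le_trans (Matrix.rank_le_card_width _) (by simp))⟩ : DimScale k') =
        rankVec (ρ a) hρa (lam j) := by
    intro j
    funext s'
    exact Fin.ext (rank_map_applyFun ρ a ha hρa (lam j) s')
  simp only [hr]
  have hp : (List.ofFn lam).Pairwise (· > ·) := by
    rw [List.pairwise_ofFn]
    exact fun i j hij => hlam hij
  have hsub := specVals_map_subset ρ a ha hρa
  have hmem : ∀ x ∈ specVals (ρ a) hρa, x ∈ List.ofFn lam := by
    intro x hx
    have := hsub hx
    rw [hspec] at this
    simpa [List.mem_ofFn] using this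
  rw [← choquet_ofFn (fun t => α (rankVec (ρ a) hρa t)) K lam, phiAlpha,
    choquet_filter _ (specVals (ρ a) hρa) _ _ _ hp hmem]
  · congr 1
    apply List.Pairwise.eq_of_mem_iff (r := (· > ·))
    · rw [List.pairwise_reverse]
      exact (Finset.sortedLT_sort _).pairwise
    · exact hp.filter _
    · intro x
      simp only [List.mem_reverse, Finset.mem_sort, List.mem_filter, decide_eq_true_eq]
      exact ⟨fun h => ⟨hmem x h, h⟩, fun h => h.2⟩
  · intro t u htu h
    congr 1
    funext s'
    apply Fin.ext
    simp only [rankVec]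
    congr 1
    ext i
    simp only [Finset.mem_filter, Finset.mem_univ, true_and]
    exact ⟨fun hi => h _ (mem_specVals _ hρa s' i) hi, htu.trans⟩
  · intro t h
    rw [← hα0]
    congr 1
    funext s'
    apply Fin.ext
    simp only [rankVec, Pi.zero_apply, Fin.val_zero, Finset.card_eq_zero]
    ext i
    simpa using h _ (mem_specVals _ hρa s' i)
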